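/- Let X ⊆ ℝⁿ be a compact convex body with 0 in its interior and let r ∈ {0, …, n−1}. Then the set of r-singular points of X, i.e., boundary points x such that the exposed face {f ∈ X* : f(x) = 1} of the polar body has affine dimension ≥ r, can be covered by countably many compact sets each of finite (n−r−1)-dimensional Hausdorff measure. -/

import Mathlib

open scoped RealInnerProductSpace MeasureTheory

/-- The polar (dual) body of a set in Euclidean space, identified with a subset of the
same space via the inner product. -/
def polarBody {n : ℕ} (X : Set (EuclideanSpace ℝ (Fin n))) : Set (EuclideanSpace ℝ (Fin n)) :=
  {f | ∀ x ∈ X, ⟪f, x⟫ ≤ 1}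

section MetricProjection

variable {E : Type*} [NormedAddCommGroup E] [InnerProductSpace ℝ E]

/-- If `x` and `y` are nearest points of a convex set to `z` and `w` respectively, in the sense of
the variational inequality, then `dist x y ≤ dist z w`. -/
theorem dist_le_dist_of_inner_sub_nonpos {z w x y : E} (hx : ⟪z - x, y - x⟫ ≤ 0)
    (hy : ⟪w - y, x - y⟫ ≤ 0) : dist x y ≤ dist z w := by
  rw [dist_eq_norm, dist_eq_norm]
  have hsq : ‖x - y‖ * ‖x - y‖ ≤ ⟪z - w, x - y⟫ := by
    rw [← real_inner_self_eq_norm_mul_norm]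
    have h1 : ⟪z - x, y - x⟫ = -⟪z - x, x - y⟫ := by rw [← inner_neg_right, neg_sub]
    have h2 : ⟪z - w, x - y⟫ = ⟪z - x, x - y⟫ + ⟪x - y, x - y⟫ - ⟪w - y, x - y⟫ := by
      rw [← inner_add_left, ← inner_sub_left]
      congr 1
      abel
    linarith
  have hcs := hsq.trans (real_inner_le_norm (z - w) (x - y))
  by_contra! hlt
  nlinarith [norm_nonneg (z - w), norm_nonneg (x - y)]

/-- A nonempty complete convex set is the image of a nonexpansive map sending `z` to `x`
whenever `z - x` is an outer normal at `x`. -/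
theorem exists_lipschitzWith_one_metricProjection {X : Set E} (hne : X.Nonempty)
    (hX : IsComplete X) (hconv : Convex ℝ X) :
    ∃ π : E → E, LipschitzWith 1 π ∧
      ∀ z, ∀ x ∈ X, (∀ y ∈ X, ⟪z - x, y - x⟫ ≤ 0) → π z = x := by
  have hex : ∀ z : E, ∃ x ∈ X, ∀ y ∈ X, ⟪z - x, y - x⟫ ≤ 0 := fun z ↦ by
    obtain ⟨x, hx, hmin⟩ := exists_norm_eq_iInf_of_complete_convex hne hX hconv z
    exact ⟨x, hx, (norm_eq_iInf_iff_real_inner_le_zero hconv hx).1 hmin⟩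
  choose π hmem hπ using hex
  refine ⟨π, LipschitzWith.mk_one fun z w ↦
    dist_le_dist_of_inner_sub_nonpos (hπ z _ (hmem w)) (hπ w _ (hmem z)), fun z x hx hzx ↦ ?_⟩
  have h := dist_le_dist_of_inner_sub_nonpos (hπ z x hx) (hzx _ (hmem z))
  rw [dist_self] at h
  exact dist_le_zero.1 h

end MetricProjection

section Transversality

variable {E : Type*} [NormedAddCommGroup E] [NormedSpace ℝ E] [FiniteDimensional ℝ E]

/-- The linear map `(t, s) ↦ U t - T s` on a product. -/
noncomputable abbrev diffMap {F G : Type*} [NormedAddCommGroup F] [NormedSpace ℝ F]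
    [NormedAddCommGroup G] [NormedSpace ℝ G] (U : F →L[ℝ] E) (T : G →L[ℝ] E) : F × G →L[ℝ] E :=
  U.comp (ContinuousLinearMap.fst ℝ F G) - T.comp (ContinuousLinearMap.snd ℝ F G)

/-- An injective linear map has a linear complement: some `T` makes `(t, s) ↦ U t - T s`
an isomorphism. -/
theorem exists_equiv_eq_diffMap {F G : Type*} [NormedAddCommGroup F] [NormedSpace ℝ F]
    [FiniteDimensional ℝ F] [NormedAddCommGroup G] [NormedSpace ℝ G] [FiniteDimensional ℝ G]
    (U : F →L[ℝ] E) (hU : Function.Injective U)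
    (hdim : Module.finrank ℝ F + Module.finrank ℝ G = Module.finrank ℝ E) :
    ∃ (T : G →L[ℝ] E) (e : (F × G) ≃L[ℝ] E), (e : F × G →L[ℝ] E) = diffMap U T := by
  obtain ⟨W, hW⟩ := Submodule.exists_isCompl (LinearMap.range (U : F →ₗ[ℝ] E))
  have hrange : Module.finrank ℝ (LinearMap.range (U : F →ₗ[ℝ] E)) = Module.finrank ℝ F :=
    LinearMap.finrank_range_of_inj hU
  have hsum := Submodule.finrank_add_eq_of_isCompl hW
  have hGW : Module.finrank ℝ G = Module.finrank ℝ W := by omega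
  let g : G ≃ₗ[ℝ] W := LinearEquiv.ofFinrankEq G W hGW
  let T : G →L[ℝ] E := LinearMap.toContinuousLinearMap (W.subtype ∘ₗ (g : G →ₗ[ℝ] W))
  have hTW : ∀ s, T s ∈ W := fun s ↦ (g s).2
  have hinj : Function.Injective (diffMap U T : F × G →ₗ[ℝ] E) := by
    rw [← LinearMap.ker_eq_bot, LinearMap.ker_eq_bot']
    rintro ⟨t, s⟩ hts
    have heq : U t = T s := sub_eq_zero.1 hts
    have hzero : U t = 0 :=
      (Submodule.disjoint_def.1 hW.disjoint) (U t) ⟨t, rfl⟩ (heq ▸ hTW s)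
    have ht : t = 0 := hU (hzero.trans (map_zero U).symm)
    have hs : g s = 0 := Subtype.ext (heq.symm.trans hzero)
    rw [ht, g.map_eq_zero_iff.1 hs]
    rfl
  refine ⟨T, (LinearEquiv.ofInjectiveOfFinrankEq (diffMap U T : F × G →ₗ[ℝ] E) hinj
    (by rw [Module.finrank_prod, hdim])).toContinuousLinearEquiv, ?_⟩
  ext v <;> rfl

/-- A relatively open piece of an affine subspace, parametrized by an injective affine map
`t ↦ p + U t`, meets some member of any dense family of affine maps of complementary dimension. -/
theorem exists_add_eq_add_of_denseRange {ι F G : Type*} [NormedAddCommGroup F] [NormedSpace ℝ F]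
    [FiniteDimensional ℝ F] [NormedAddCommGroup G] [NormedSpace ℝ G] [FiniteDimensional ℝ G]
    {D : ι → E × (G →L[ℝ] E)} (hD : DenseRange D)
    (U : F →L[ℝ] E) (hU : Function.Injective U)
    (hdim : Module.finrank ℝ F + Module.finrank ℝ G = Module.finrank ℝ E)
    (p : E) {ε : ℝ} (hε : 0 < ε) :
    ∃ (i : ι) (t : F) (s : G), ‖t‖ < ε ∧ p + U t = (D i).1 + (D i).2 s := by
  have : CompleteSpace F := FiniteDimensional.complete ℝ F
  have : CompleteSpace G := FiniteDimensional.complete ℝ G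
  obtain ⟨T₀, e, he⟩ := exists_equiv_eq_diffMap U hU hdim
  have hM : Continuous fun q : E × (G →L[ℝ] E) ↦ diffMap U q.2 :=
    continuous_const.sub (continuous_snd.clm_comp continuous_const)
  have hMe : diffMap U (p, T₀).2 = (e : F × G →L[ℝ] E) := he.symm
  have hinv : ContinuousAt (fun q : E × (G →L[ℝ] E) ↦
      (diffMap U q.2).inverse (q.1 - p)) (p, T₀) := by
    refine ContinuousAt.clm_apply ?_ (by fun_prop)
    refine ContinuousAt.comp (g := ContinuousLinearMap.inverse)
      (f := fun q : E × (G →L[ℝ] E) ↦ diffMap U q.2) ?_ hM.continuousAt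
    rw [hMe]
    exact (contDiffAt_map_inverse (n := 0) e).continuousAt
  have hsmall : ∀ᶠ q in nhds ((p, T₀) : E × (G →L[ℝ] E)),
      ‖(diffMap U q.2).inverse (q.1 - p)‖ < ε := by
    refine hinv.norm.eventually_lt_const ?_
    simpa using hε
  have hequiv : ∀ᶠ q in nhds ((p, T₀) : E × (G →L[ℝ] E)),
      diffMap U q.2 ∈ Set.range ((↑) : ((F × G) ≃L[ℝ] E) → F × G →L[ℝ] E) :=
    hM.continuousAt.eventually_mem (hMe ▸ ContinuousLinearEquiv.nhds e)
  obtain ⟨_, ⟨i, rfl⟩, hq, e', he'⟩ := hD.inter_nhds_nonempty (hsmall.and hequiv)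
  set v := (diffMap U (D i).2).inverse ((D i).1 - p) with hv
  have hv' : U v.1 - (D i).2 v.2 = (D i).1 - p := by
    change diffMap U (D i).2 v = _
    rw [hv, ← he', ContinuousLinearMap.inverse_equiv]
    exact e'.apply_symm_apply _
  refine ⟨i, v.1, v.2, (norm_fst_le v).trans_lt hq, ?_⟩
  rw [sub_eq_iff_eq_add] at hv'
  rw [hv']
  abel

end Transversality

section ExposedFace

variable {n : ℕ} {X : Set (EuclideanSpace ℝ (Fin n))} {x : EuclideanSpace ℝ (Fin n)}

/-- Every boundary point of a convex body around the origin has a supporting functional in the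
polar body. -/
theorem exists_mem_polarBody_inner_eq_one (hXv : Convex ℝ X)
    (h0 : 0 ∈ interior X) (hx : x ∈ frontier X) : ∃ f ∈ polarBody X, ⟪f, x⟫ = 1 := by
  obtain ⟨f, hf⟩ := geometric_hahn_banach_open_point hXv.interior isOpen_interior hx.2
  have hpos : 0 < f x := by simpa using hf 0 h0
  have hle : ∀ y ∈ X, f y ≤ f x := fun y hy ↦ by
    have hcl : y ∈ closure (interior X) := by
      rw [hXv.closure_interior_eq_closure_of_nonempty_interior ⟨0, h0⟩]
      exact subset_closure hy
    exact closure_minimal (fun a ha ↦ (hf a ha).le)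
      (isClosed_le f.continuous continuous_const) hcl
  refine ⟨(f x)⁻¹ • (InnerProductSpace.toDual ℝ _).symm f, fun y hy ↦ ?_, ?_⟩
  · rw [real_inner_smul_left, InnerProductSpace.toDual_symm_apply]
    exact inv_mul_le_one_of_le₀ (hle y hy) hpos.le
  · rw [real_inner_smul_left, InnerProductSpace.toDual_symm_apply, inv_mul_cancel₀ hpos.ne']

/-- The linear span of a nonempty set contained in the hyperplane `⟪·, x⟫ = 1` has larger dimension
than its affine span. -/
theorem finrank_direction_affineSpan_lt_finrank_span {G : Set (EuclideanSpace ℝ (Fin n))}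
    (hG : G.Nonempty) (hGx : ∀ f ∈ G, ⟪f, x⟫ = 1) :
    Module.finrank ℝ (affineSpan ℝ G).direction < Module.finrank ℝ (Submodule.span ℝ G) := by
  obtain ⟨f, hf⟩ := hG
  rw [direction_affineSpan]
  refine Submodule.finrank_lt_finrank_of_lt (SetLike.lt_iff_le_and_exists.2
    ⟨?_, f, Submodule.subset_span hf, fun hmem ↦ ?_⟩)
  · refine Submodule.span_le.2 ?_
    rintro _ ⟨a, ha, b, hb, rfl⟩
    exact Submodule.sub_mem _ (Submodule.subset_span ha) (Submodule.subset_span hb)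
  · have hker : vectorSpan ℝ G ≤ LinearMap.ker (innerₗ (EuclideanSpace ℝ (Fin n)) x) := by
      refine Submodule.span_le.2 ?_
      rintro _ ⟨a, ha, b, hb, rfl⟩
      change ⟪x, a - b⟫ = 0
      rw [inner_sub_right, real_inner_comm, hGx a ha, real_inner_comm, hGx b hb, sub_self]
    have hfx : ⟪x, f⟫ = 0 := hker hmem
    rw [real_inner_comm, hGx f hf] at hfx
    exact one_ne_zero hfx

/-- An `r`-singular boundary point has `r + 1` linearly independent supporting functionals in the
polar body. -/
theorem exists_linearIndependent_polarBody (hXv : Convex ℝ X)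
    (h0 : 0 ∈ interior X) (hx : x ∈ frontier X) {r : ℕ}
    (hr : r ≤ Module.finrank ℝ (affineSpan ℝ {f ∈ polarBody X | ⟪f, x⟫ = 1}).direction) :
    ∃ u : Fin (r + 1) → EuclideanSpace ℝ (Fin n),
      LinearIndependent ℝ u ∧ ∀ i, u i ∈ polarBody X ∧ ⟪u i, x⟫ = 1 := by
  obtain ⟨f, hf⟩ := exists_mem_polarBody_inner_eq_one hXv h0 hx
  have hlt := finrank_direction_affineSpan_lt_finrank_span (x := x)
    (G := {f ∈ polarBody X | ⟪f, x⟫ = 1}) ⟨f, hf⟩ fun g hg ↦ hg.2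
  obtain ⟨u, hu, -, hli⟩ :=
    Submodule.exists_fun_fin_finrank_span_eq ℝ {f ∈ polarBody X | ⟪f, x⟫ = 1}
  have hle := Nat.succ_le_of_lt (hr.trans_lt hlt)
  exact ⟨u ∘ Fin.castLE hle, hli.comp _ (Fin.castLE_injective hle), fun i ↦ hu _⟩

end ExposedFace

/-- A Lipschitz image of a compact subset of `ℝᵐ` has finite `m`-dimensional Hausdorff measure. -/
theorem LipschitzWith.hausdorffMeasure_image_lt_top {m : ℕ} {Y : Type*} [EMetricSpace Y]
    [MeasurableSpace Y] [BorelSpace Y] {K : NNReal} {φ : (Fin m → ℝ) → Y}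
    (hφ : LipschitzWith K φ) {s : Set (Fin m → ℝ)} (hs : IsCompact s) :
    μH[(m : ℝ)] (φ '' s) < ⊤ := by
  refine (hφ.hausdorffMeasure_image_le m.cast_nonneg s).trans_lt (ENNReal.mul_lt_top ?_ ?_)
  · exact ENNReal.rpow_lt_top_of_nonneg m.cast_nonneg ENNReal.coe_ne_top
  · have h := MeasureTheory.hausdorffMeasure_pi_real (ι := Fin m)
    rw [Fintype.card_fin] at h
    rw [h]
    exact hs.measure_lt_top

theorem anderson_klee {n : ℕ} (X : Set (EuclideanSpace ℝ (Fin n)))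
    (hXc : IsCompact X) (hXv : Convex ℝ X) (h0 : 0 ∈ interior X)
    (r : ℕ) (hr : r ≤ n - 1) :
    ∃ C : ℕ → Set (EuclideanSpace ℝ (Fin n)),
      (∀ i, IsCompact (C i) ∧ μH[(n : ℝ) - r - 1] (C i) < ⊤) ∧
      {x ∈ frontier X |
        r ≤ Module.finrank ℝ (affineSpan ℝ {f ∈ polarBody X | ⟪f, x⟫ = 1}).direction}
        ⊆ ⋃ i, C i := by
  rcases Nat.eq_zero_or_pos n with rfl | hn
  · refine ⟨fun _ ↦ ∅, fun _ ↦ ⟨isCompact_empty, by simp⟩, fun x hx ↦ ?_⟩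
    exact absurd (Subsingleton.elim (0 : EuclideanSpace ℝ (Fin 0)) x ▸ h0) hx.1.2
  obtain ⟨m, rfl⟩ : ∃ m, n = r + 1 + m := ⟨n - (r + 1), by omega⟩
  have hm : ((r + 1 + m : ℕ) : ℝ) - r - 1 = m := by push_cast; ring
  obtain ⟨π, hπ, hπX⟩ := exists_lipschitzWith_one_metricProjection
    ⟨0, interior_subset h0⟩ hXc.isComplete hXv
  let D : ℕ → EuclideanSpace ℝ (Fin (r + 1 + m)) ×
    ((Fin m → ℝ) →L[ℝ] EuclideanSpace ℝ (Fin (r + 1 + m))) := TopologicalSpace.denseSeq _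
  have hlip : ∀ i, LipschitzWith (1 * ‖(D i).2‖₊) fun s ↦ π ((D i).1 + (D i).2 s) := fun i ↦
    hπ.comp (LipschitzWith.of_dist_le_mul fun s t ↦ by
      rw [dist_add_left]; exact (D i).2.lipschitz.dist_le_mul s t)
  refine ⟨fun k ↦ (fun s ↦ π ((D k.unpair.1).1 + (D k.unpair.1).2 s)) ''
    Metric.closedBall 0 k.unpair.2, fun k ↦ ⟨?_, ?_⟩, fun x hx ↦ ?_⟩
  · exact (isCompact_closedBall _ _).image (hlip _).continuous
  · rw [hm]
    exact (hlip _).hausdorffMeasure_image_lt_top (isCompact_closedBall _ _)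
  obtain ⟨u, hli, hu⟩ := exists_linearIndependent_polarBody hXv h0 hx.1 hx.2
  let U : (Fin (r + 1) → ℝ) →L[ℝ] EuclideanSpace ℝ (Fin (r + 1 + m)) :=
    LinearMap.toContinuousLinearMap (Fintype.linearCombination ℝ u)
  have hU : Function.Injective U := hli.fintypeLinearCombination_injective
  have hUapp : ∀ t, U t = ∑ i, t i • u i := fun t ↦ Fintype.linearCombination_apply ℝ u t
  obtain ⟨i, t, s, ht, hts⟩ := exists_add_eq_add_of_denseRange
    (D := D) (TopologicalSpace.denseRange_denseSeq _) U hU (by simp)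
    (x + U 1) one_pos
  obtain ⟨N, hN⟩ := exists_nat_ge ‖s‖
  refine Set.mem_iUnion.2 ⟨Nat.pair i N, s, ?_, ?_⟩
  · simpa using hN
  · have hxX : x ∈ X := hXc.isClosed.frontier_subset hx.1
    simp only [Nat.unpair_pair]
    refine hπX _ x hxX fun y hy ↦ ?_
    have hnormal : (D i).1 + (D i).2 s - x = ∑ j, (1 + t j) • u j := by
      rw [← hts, add_assoc x, add_sub_cancel_left, ← map_add, hUapp]
      rfl
    rw [hnormal, sum_inner]
    refine Finset.sum_nonpos fun j _ ↦ ?_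
    rw [real_inner_smul_left, inner_sub_right, (hu j).2]
    have htj : |t j| < 1 := (norm_le_pi_norm t j).trans_lt ht
    exact mul_nonpos_of_nonneg_of_nonpos (by linarith [(abs_lt.1 htj).1])
      (sub_nonpos.2 ((hu j).1 y hy))
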